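/- Let d be a function on (x_L,x_R) with d(x) ∈ [κ_min, κ_max] for positive constants κ_min, κ_max, suppose d is convex on (x_L,x_R), and assume κ_min − ν_α > 0, where ν_α = √2·(κ_max − κ_min)/ς_α. Let η > 0, D = diag(d(x_1),…,d(x_M)), d̄ = (1/M)·Σ_{i=1}^{M} d(x_i), A = I_M − η·D·G_α and P = I_M − η·d̄·G_α. Then P is invertible and, for every nonzero y ∈ ℝ^M, š ≤ ‖A·P⁻¹·y‖₂²/‖y‖₂² ≤ ŝ, where š = min{(κ_min − ν_α)/κ_max, κ_min²/κ_max²} and ŝ = max{(κ_min + ν_α)/κ_min, κ_max²/κ_min²}. Consequently every singular value of A·P⁻¹ lies in [√š, √ŝ] and the spectral condition number satisfies cond(A·P⁻¹) = ‖A·P⁻¹‖₂·‖(A·P⁻¹)⁻¹‖₂ ≤ √(ŝ/š), a bound independent of M, η, τ and h. -/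

import Mathlib

open Matrix

/-- The Grünwald–Letnikov coefficients `g_k^{(α)}`. -/
noncomputable def gcoef (α : ℝ) : ℕ → ℝ
  | 0 => 1
  | (k+1) => (1 - (α + 1) / (k + 1 : ℕ)) * gcoef α k

/-- The WSGD coefficients `w_k^{(α)}`. -/
noncomputable def wcoef (α : ℝ) : ℕ → ℝ
  | 0 => α / 2 * gcoef α 0
  | (k+1) => α / 2 * gcoef α (k+1) + (2 - α) / 2 * gcoef α k

/-- The `M × M` lower-Hessenberg Toeplitz matrix `G_α`. -/
noncomputable def Gmat (α : ℝ) (M : ℕ) : Matrix (Fin M) (Fin M) ℝ :=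
  Matrix.of fun i j => if (j : ℕ) ≤ (i : ℕ) + 1 then wcoef α ((i : ℕ) + 1 - (j : ℕ)) else 0

lemma gcoef_succ_nonneg {α : ℝ} (h1 : 1 ≤ α) (h2 : α ≤ 2) (k : ℕ) : 0 ≤ gcoef α (k + 2) := by
  induction k with
  | zero => simp only [gcoef]; norm_num; nlinarith
  | succ k ih =>
    have hk : (α + 1) / ((k + 2 + 1 : ℕ) : ℝ) ≤ 1 := by
      rw [div_le_one (by positivity)]; push_cast; linarith [(Nat.cast_nonneg k : (0 : ℝ) ≤ k)]
    rw [show k + 1 + 2 = (k + 2) + 1 by ring, gcoef]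
    exact mul_nonneg (by linarith) ih

lemma mul_sum_gcoef (α : ℝ) (n : ℕ) :
    α * ∑ k ∈ Finset.range (n + 1), gcoef α k = -((n + 1 : ℕ) : ℝ) * gcoef α (n + 1) := by
  induction n with
  | zero => simp [gcoef]
  | succ n ih =>
    rw [Finset.sum_range_succ, mul_add, ih, gcoef.eq_2 α (n + 1)]
    field_simp
    push_cast
    ring

lemma sum_gcoef_nonpos {α : ℝ} (h1 : 1 ≤ α) (h2 : α ≤ 2) (n : ℕ) :
    ∑ k ∈ Finset.range (n + 2), gcoef α k ≤ 0 := by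
  have h := mul_sum_gcoef α (n + 1)
  have hg := gcoef_succ_nonneg h1 h2 n
  have hn : (0 : ℝ) ≤ ((n + 1 + 1 : ℕ) : ℝ) := by positivity
  by_contra! hc
  have := mul_pos (by linarith : 0 < α) hc
  nlinarith [mul_nonneg hn hg]

lemma summable_gcoef {α : ℝ} (h1 : 1 ≤ α) (h2 : α ≤ 2) : Summable (gcoef α) := by
  rw [← summable_nat_add_iff 2]
  refine summable_of_sum_range_le (c := α) (gcoef_succ_nonneg h1 h2) fun n => ?_
  have h := sum_gcoef_nonpos h1 h2 n
  rw [add_comm, Finset.sum_range_add] at h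
  simp only [Finset.sum_range_succ, Finset.sum_range_zero, gcoef] at h
  norm_num at h
  simp only [add_comm _ 2]
  linarith

lemma wcoef_nonneg {α : ℝ} (h1 : 1 ≤ α) (h2 : α ≤ 2) (k : ℕ) : 0 ≤ wcoef α (k + 3) := by
  have := gcoef_succ_nonneg h1 h2 k
  have := gcoef_succ_nonneg h1 h2 (k + 1)
  rw [wcoef]
  have h3 : 0 ≤ (2 - α) / 2 := by linarith
  have h4 : 0 ≤ α / 2 := by linarith
  positivity

lemma wcoef_zero_add_two_nonneg {α : ℝ} (h1 : 1 ≤ α) : 0 ≤ wcoef α 0 + wcoef α 2 := by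
  have : wcoef α 0 + wcoef α 2 = α * (α + 2) * (α - 1) / 4 := by
    simp only [wcoef, gcoef]; norm_num; ring
  rw [this]
  have : 0 ≤ α - 1 := by linarith
  positivity

lemma sum_wcoef_succ (α : ℝ) (n : ℕ) :
    ∑ k ∈ Finset.range (n + 1), wcoef α k =
      α / 2 * ∑ k ∈ Finset.range (n + 1), gcoef α k
        + (2 - α) / 2 * ∑ k ∈ Finset.range n, gcoef α k := by
  rw [Finset.sum_range_succ', Finset.sum_range_succ' (gcoef α)]
  simp only [wcoef, Finset.sum_add_distrib, ← Finset.mul_sum]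
  ring

lemma sum_wcoef_nonpos {α : ℝ} (h1 : 1 ≤ α) (h2 : α ≤ 2) (n : ℕ) :
    ∑ k ∈ Finset.range (n + 3), wcoef α k ≤ 0 := by
  rw [sum_wcoef_succ]
  have h3 : 0 ≤ (2 - α) / 2 := by linarith
  have h4 : 0 ≤ α / 2 := by linarith
  have := mul_nonneg h3 (neg_nonneg.2 (sum_gcoef_nonpos h1 h2 n))
  have := mul_nonneg h4 (neg_nonneg.2 (sum_gcoef_nonpos h1 h2 (n + 1)))
  linarith

lemma summable_wcoef {α : ℝ} (h1 : 1 ≤ α) (h2 : α ≤ 2) : Summable (wcoef α) := by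
  rw [← summable_nat_add_iff 1]
  have h := summable_gcoef h1 h2
  exact (((summable_nat_add_iff 1).2 h).mul_left _).add (h.mul_left _)

lemma gcoef_eq_choose (α : ℝ) (k : ℕ) :
    gcoef α k = (-1) ^ k * Ring.choose α k := by
  induction k with
  | zero => simp [gcoef]
  | succ k ih =>
    rw [gcoef, ih, Ring.choose_eq_smul, Ring.choose_eq_smul, descPochhammer_succ_right,
      Polynomial.smeval_mul, Nat.factorial_succ]
    simp [Polynomial.smeval_natCast]
    field_simp
    ring

lemma hasSum_gcoef_mul_pow (α : ℝ) {z : ℂ} (hz : ‖z‖ < 1) :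
    HasSum (fun k => (gcoef α k : ℂ) * z ^ k) ((1 - z) ^ (α : ℂ)) := by
  have h := (Complex.one_add_cpow_hasFPowerSeriesOnBall_zero (a := (α : ℂ))).hasSum
    (y := -z) (by simpa [← ENNReal.ofReal_one, Metric.eball_ofReal] using hz)
  rw [zero_add] at h
  simp only [binomialSeries_apply, List.ofFn_const, List.prod_replicate,
    smul_eq_mul, ← sub_eq_add_neg] at h
  convert! h using 2 with k
  rw [gcoef_eq_choose, neg_pow, ← Complex.ofReal_choose]
  push_cast
  ring

/-- The generating function of the coefficients `w_k`. -/
noncomputable def wgen (α : ℝ) (z : ℂ) : ℂ := ∑' k, (wcoef α k : ℂ) * z ^ k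

lemma wgen_eq_of_norm_lt_one (α : ℝ) {z : ℂ} (hz : ‖z‖ < 1) :
    wgen α z = ((α / 2 : ℝ) + ((2 - α) / 2 : ℝ) * z) * (1 - z) ^ (α : ℂ) := by
  have h := hasSum_gcoef_mul_pow α hz
  refine HasSum.tsum_eq ?_
  rw [← hasSum_nat_add_iff' 1]
  have h' := (hasSum_nat_add_iff' 1).2 h
  convert! (h'.mul_left ((α / 2 : ℝ) : ℂ)).add (h.mul_left (((2 - α) / 2 : ℝ) * z)) using 1
  · ext k
    simp only [wcoef]
    push_cast
    ring
  · simp [wcoef, gcoef]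
    ring

lemma summable_norm_wcoef {α : ℝ} (h1 : 1 ≤ α) (h2 : α ≤ 2) :
    Summable fun k => ‖(wcoef α k : ℂ)‖ := by
  simpa using (summable_wcoef h1 h2).abs

lemma continuousOn_wgen {α : ℝ} (h1 : 1 ≤ α) (h2 : α ≤ 2) :
    ContinuousOn (wgen α) (Metric.closedBall 0 1) := by
  refine continuousOn_tsum (fun k => by fun_prop) (summable_norm_wcoef h1 h2) fun k z hz => ?_
  rw [norm_mul, norm_pow]
  exact mul_le_of_le_one_right (norm_nonneg _)
    (pow_le_one₀ (norm_nonneg _) (by simpa using hz))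

lemma wgen_eq_of_norm_eq_one {α : ℝ} (h1 : 1 ≤ α) (h2 : α ≤ 2) {z : ℂ} (hz : ‖z‖ = 1)
    (hz1 : 1 - z ∈ Complex.slitPlane) :
    wgen α z = ((α / 2 : ℝ) + ((2 - α) / 2 : ℝ) * z) * (1 - z) ^ (α : ℂ) := by
  have hz' : z ∈ closure (Metric.ball (0 : ℂ) 1) := by
    rw [closure_ball _ one_ne_zero]; simp [hz]
  have : (nhdsWithin z (Metric.ball 0 1)).NeBot := mem_closure_iff_nhdsWithin_neBot.1 hz'
  have hl : Filter.Tendsto (wgen α) (nhdsWithin z (Metric.ball 0 1)) (nhds (wgen α z)) :=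
    (continuousOn_wgen h1 h2 z (by simp [hz])).mono Metric.ball_subset_closedBall
  have hr : ContinuousAt
      (fun z : ℂ => ((α / 2 : ℝ) + ((2 - α) / 2 : ℝ) * z) * (1 - z) ^ (α : ℂ)) z := by
    refine ContinuousAt.mul (by fun_prop) (ContinuousAt.cpow (by fun_prop) (by fun_prop) hz1)
  refine tendsto_nhds_unique hl ((hr.tendsto.mono_left nhdsWithin_le_nhds).congr' ?_)
  filter_upwards [self_mem_nhdsWithin] with y hy
  exact (wgen_eq_of_norm_lt_one α (by simpa using hy)).symm

lemma sin_convex_comb_le {β θ : ℝ} (h0 : 0 < β) (h1 : β < 1 / 2) (hθ0 : 0 ≤ θ)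
    (hθ : θ ≤ Real.pi) : β * Real.sin ((1 - β) * θ) ≤ (1 - β) * Real.sin (β * θ) := by
  have hb : 0 < 1 - β := by linarith
  have hx : (1 - β) * θ ∈ Set.Icc 0 Real.pi := ⟨by positivity, by nlinarith⟩
  have hy : (0 : ℝ) ∈ Set.Icc 0 Real.pi := ⟨le_rfl, Real.pi_pos.le⟩
  have hβ : 0 ≤ 1 - β / (1 - β) := by rw [sub_nonneg, div_le_one hb]; linarith
  have hs := strictConcaveOn_sin_Icc.concaveOn.2 hx hy (by positivity : 0 ≤ β / (1 - β)) hβ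
    (by ring)
  simp only [smul_eq_mul, Real.sin_zero, mul_zero, add_zero] at hs
  rw [show β / (1 - β) * ((1 - β) * θ) = β * θ by field_simp, div_mul_eq_mul_div,
    div_le_iff₀ hb] at hs
  linarith

lemma cos_mul_norm_le_re_of_le_pi {β θ : ℝ} (h0 : 0 < β) (h1 : β < 1 / 2) (hθ0 : 0 ≤ θ)
    (hθ : θ ≤ Real.pi) :
    let R := (1 - β) * Real.cos (β * (Real.pi - θ)) + β * Real.cos (β * (Real.pi - θ) + θ)
    let S := (1 - β) * Real.sin (β * (Real.pi - θ)) + β * Real.sin (β * (Real.pi - θ) + θ)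
    0 ≤ R ∧ Real.cos (β * Real.pi) ^ 2 * (R ^ 2 + S ^ 2) ≤ R ^ 2 := by
  intro R S
  have hpi := Real.pi_pos
  have hS : 0 ≤ S := by
    have hnn : 0 ≤ β * (Real.pi - θ) := mul_nonneg h0.le (by linarith)
    have hle : β * (Real.pi - θ) ≤ Real.pi - θ := by nlinarith
    have e1 := Real.sin_nonneg_of_nonneg_of_le_pi hnn (by linarith)
    have e2 := Real.sin_nonneg_of_nonneg_of_le_pi (x := β * (Real.pi - θ) + θ)
      (by linarith) (by linarith)
    have : 0 ≤ 1 - β := by linarith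
    positivity
  have hc : 0 < Real.cos (β * Real.pi) := Real.cos_pos_of_mem_Ioo ⟨by nlinarith, by nlinarith⟩
  have hs : 0 < Real.sin (β * Real.pi) := Real.sin_pos_of_pos_of_lt_pi (by positivity) (by nlinarith)
  have key : S * Real.cos (β * Real.pi) ≤ R * Real.sin (β * Real.pi) := by
    have e : S * Real.cos (β * Real.pi) - R * Real.sin (β * Real.pi)
        = β * Real.sin ((1 - β) * θ) - (1 - β) * Real.sin (β * θ) := by
      rw [show (1 - β) * θ = (β * (Real.pi - θ) + θ) - β * Real.pi by ring,
        show β * θ = β * Real.pi - β * (Real.pi - θ) by ring, Real.sin_sub, Real.sin_sub]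
      simp only [R, S]
      ring
    linarith [sin_convex_comb_le h0 h1 hθ0 hθ]
  have hR : 0 ≤ R := by
    by_contra! hneg
    nlinarith [mul_nonneg hS hc.le, mul_pos (neg_pos.2 hneg) hs]
  refine ⟨hR, ?_⟩
  have hsq : (S * Real.cos (β * Real.pi)) ^ 2 ≤ (R * Real.sin (β * Real.pi)) ^ 2 :=
    pow_le_pow_left₀ (by positivity) key 2
  rw [mul_pow, mul_pow, Real.sin_sq] at hsq
  linarith

lemma cos_mul_norm_le_re {β θ : ℝ} (h0 : 0 < β) (h1 : β < 1 / 2) (hθ0 : 0 ≤ θ)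
    (hθ : θ ≤ 2 * Real.pi) {Z : ℂ}
    (hZ : Z = Complex.exp ((β * (Real.pi - θ) : ℝ) * Complex.I)
      * ((1 - β : ℝ) + (β : ℝ) * Complex.exp (θ * Complex.I))) :
    Real.cos (β * Real.pi) * ‖Z‖ ≤ Z.re := by
  have hZ' : Z = (1 - β : ℝ) * Complex.exp ((β * (Real.pi - θ) : ℝ) * Complex.I)
      + (β : ℝ) * Complex.exp ((β * (Real.pi - θ) + θ : ℝ) * Complex.I) := by
    rw [hZ, Complex.ofReal_add (β * (Real.pi - θ)), add_mul, Complex.exp_add]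
    ring
  have hre : Z.re = (1 - β) * Real.cos (β * (Real.pi - θ))
      + β * Real.cos (β * (Real.pi - θ) + θ) := by
    rw [hZ', Complex.add_re, Complex.re_ofReal_mul, Complex.re_ofReal_mul,
      Complex.exp_ofReal_mul_I_re, Complex.exp_ofReal_mul_I_re]
  have him : Z.im = (1 - β) * Real.sin (β * (Real.pi - θ))
      + β * Real.sin (β * (Real.pi - θ) + θ) := by
    rw [hZ', Complex.add_im, Complex.im_ofReal_mul, Complex.im_ofReal_mul,
      Complex.exp_ofReal_mul_I_im, Complex.exp_ofReal_mul_I_im]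
  have main : 0 ≤ Z.re ∧ Real.cos (β * Real.pi) ^ 2 * (Z.re ^ 2 + Z.im ^ 2) ≤ Z.re ^ 2 := by
    rw [hre, him]
    rcases le_total θ Real.pi with h | h
    · exact cos_mul_norm_le_re_of_le_pi h0 h1 hθ0 h
    · have := cos_mul_norm_le_re_of_le_pi h0 h1 (θ := 2 * Real.pi - θ) (by linarith) (by linarith)
      rw [show β * (Real.pi - (2 * Real.pi - θ)) + (2 * Real.pi - θ)
        = 2 * Real.pi - (β * (Real.pi - θ) + θ) by ring,
        show β * (Real.pi - (2 * Real.pi - θ)) = -(β * (Real.pi - θ)) by ring,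
        Real.cos_two_pi_sub, Real.sin_two_pi_sub, Real.cos_neg, Real.sin_neg] at this
      refine ⟨this.1, this.2.trans' (le_of_eq ?_)⟩
      ring
  refine le_of_sq_le_sq ?_ main.1
  rw [mul_pow, Complex.sq_norm, Complex.normSq_apply]
  simpa only [sq] using main.2

lemma one_sub_exp_mul_I (θ : ℝ) :
    1 - Complex.exp (θ * Complex.I)
      = (2 * Real.sin (θ / 2) : ℝ) * Complex.exp (((θ - Real.pi) / 2 : ℝ) * Complex.I) := by
  have hc : Real.cos θ = 1 - 2 * Real.sin (θ / 2) ^ 2 := by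
    rw [show θ = 2 * (θ / 2) by ring, Real.cos_two_mul, Real.cos_sq']; ring_nf
  have hs : Real.sin θ = 2 * Real.sin (θ / 2) * Real.cos (θ / 2) := by
    rw [show θ = 2 * (θ / 2) by ring, Real.sin_two_mul]; ring_nf
  have h1 : Real.cos ((θ - Real.pi) / 2) = Real.sin (θ / 2) := by
    rw [show (θ - Real.pi) / 2 = θ / 2 - Real.pi / 2 by ring, Real.cos_sub_pi_div_two]
  have h2 : Real.sin ((θ - Real.pi) / 2) = -Real.cos (θ / 2) := by
    rw [show (θ - Real.pi) / 2 = θ / 2 - Real.pi / 2 by ring, Real.sin_sub_pi_div_two]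
  apply Complex.ext
  · rw [Complex.re_ofReal_mul, Complex.exp_ofReal_mul_I_re, Complex.sub_re,
      Complex.exp_ofReal_mul_I_re, h1, hc, Complex.one_re]
    ring
  · rw [Complex.im_ofReal_mul, Complex.exp_ofReal_mul_I_im, Complex.sub_im,
      Complex.exp_ofReal_mul_I_im, h2, hs, Complex.one_im]
    ring

/-- The generating symbol of `-G_α` lies in a sector around the positive real axis. -/
lemma abs_cos_mul_norm_wgen_le {α : ℝ} (hα : α ∈ Set.Ioo (1 : ℝ) 2) {θ : ℝ} (hθ0 : 0 < θ)
    (hθ : θ < 2 * Real.pi) :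
    |Real.cos (α * Real.pi / 2)| * ‖wgen α (Complex.exp (θ * Complex.I))‖ ≤
      (-(Complex.exp (-(θ * Complex.I)) * wgen α (Complex.exp (θ * Complex.I)))).re := by
  obtain ⟨hα1, hα2⟩ := hα
  have hpi := Real.pi_pos
  have hr : 0 < 2 * Real.sin (θ / 2) := by
    have := Real.sin_pos_of_pos_of_lt_pi (x := θ / 2) (by linarith) (by linarith)
    positivity
  set r := 2 * Real.sin (θ / 2) with hrdef
  have h1 := one_sub_exp_mul_I θ
  rw [← hrdef] at h1
  have hlog : Complex.log (1 - Complex.exp (θ * Complex.I))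
      = Real.log r + ((θ - Real.pi) / 2 : ℝ) * Complex.I := by
    rw [h1, Complex.log_ofReal_mul hr (Complex.exp_ne_zero _), Complex.log_exp]
    · simp; linarith
    · simp; linarith
  have hslit : 1 - Complex.exp (θ * Complex.I) ∈ Complex.slitPlane := by
    left
    rw [h1, Complex.re_ofReal_mul, Complex.exp_ofReal_mul_I_re]
    exact mul_pos hr (Real.cos_pos_of_mem_Ioo ⟨by linarith, by linarith⟩)
  have hw := wgen_eq_of_norm_eq_one hα1.le hα2.le (Complex.norm_exp_ofReal_mul_I θ) hslit
  rw [Complex.cpow_def_of_ne_zero (Complex.slitPlane_ne_zero hslit), hlog] at hw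
  set β := 1 - α / 2 with hβ
  set Z := Complex.exp ((β * (Real.pi - θ) : ℝ) * Complex.I)
      * ((1 - β : ℝ) + (β : ℝ) * Complex.exp (θ * Complex.I)) with hZ
  have key := cos_mul_norm_le_re (β := β) (by linarith) (by linarith) hθ0.le hθ.le hZ
  have hcos : |Real.cos (α * Real.pi / 2)| = Real.cos (β * Real.pi) := by
    rw [show β * Real.pi = Real.pi - α * Real.pi / 2 by rw [hβ]; ring, Real.cos_pi_sub, abs_of_nonpos]
    exact Real.cos_nonpos_of_pi_div_two_le_of_le (by nlinarith) (by nlinarith)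
  have hZw : -(Complex.exp (-(θ * Complex.I)) * wgen α (Complex.exp (θ * Complex.I)))
      = (Real.exp (α * Real.log r) : ℝ) * Z := by
    have hexp : Complex.exp ((Real.log r + ((θ - Real.pi) / 2 : ℝ) * Complex.I) * α)
        = (Real.exp (α * Real.log r) : ℝ)
          * -(Complex.exp (θ * Complex.I) * Complex.exp ((β * (Real.pi - θ) : ℝ) * Complex.I)) := by
      rw [← neg_one_mul, ← Complex.exp_pi_mul_I, Complex.ofReal_exp, ← Complex.exp_add,
        ← Complex.exp_add, ← Complex.exp_add, Complex.exp_eq_exp_iff_exists_int]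
      refine ⟨-1, ?_⟩
      rw [hβ]
      push_cast
      ring
    rw [hw, hexp, hZ, Complex.exp_neg, show (2 - α) / 2 = β by rw [hβ]; ring,
      show α / 2 = 1 - β by rw [hβ]; ring]
    field_simp [Complex.exp_ne_zero]
  have hnorm : ‖wgen α (Complex.exp (θ * Complex.I))‖ = Real.exp (α * Real.log r) * ‖Z‖ := by
    have := congrArg norm hZw
    rw [norm_neg, norm_mul, norm_mul, ← neg_mul, ← Complex.ofReal_neg,
      Complex.norm_exp_ofReal_mul_I, one_mul, Complex.norm_real, Real.norm_eq_abs,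
      Real.abs_exp] at this
    exact this
  rw [hnorm, hZw, Complex.re_ofReal_mul, hcos]
  nlinarith [Real.exp_pos (α * Real.log r)]

lemma integral_exp_int_mul_I (m : ℤ) :
    ∫ θ in (0 : ℝ)..(2 * Real.pi), Complex.exp (m * (θ * Complex.I))
      = if m = 0 then ((2 * Real.pi : ℝ) : ℂ) else 0 := by
  split_ifs with h
  · simp [h]
  · have hc : (m : ℂ) * Complex.I ≠ 0 := mul_ne_zero (by exact_mod_cast h) Complex.I_ne_zero
    have := integral_exp_mul_complex (a := 0) (b := 2 * Real.pi) hc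
    simp only [show ∀ θ : ℝ, (m : ℂ) * (θ * Complex.I) = m * Complex.I * θ by intros; ring]
    rw [this, show (m : ℂ) * Complex.I * (2 * Real.pi : ℝ) = m * (2 * Real.pi * Complex.I) by
      push_cast; ring, Complex.exp_int_mul_two_pi_mul_I]
    simp

lemma continuous_wgen_exp {α : ℝ} (h1 : 1 ≤ α) (h2 : α ≤ 2) :
    Continuous fun θ : ℝ => wgen α (Complex.exp (θ * Complex.I)) :=
  (continuousOn_wgen h1 h2).comp_continuous (by fun_prop) fun θ => by
    simp [Complex.norm_exp_ofReal_mul_I]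

lemma integral_wgen_mul_exp {α : ℝ} (h1 : 1 ≤ α) (h2 : α ≤ 2) (m : ℤ) :
    ∫ θ in (0 : ℝ)..(2 * Real.pi),
        wgen α (Complex.exp (θ * Complex.I)) * Complex.exp (m * (θ * Complex.I))
      = ((2 * Real.pi : ℝ) : ℂ) * (if m ≤ 0 then wcoef α (-m).toNat else 0 : ℝ) := by
  let F : ℕ → C(ℝ, ℂ) := fun k =>
    ⟨fun θ => wcoef α k * Complex.exp (((k : ℤ) + m : ℤ) * (θ * Complex.I)), by fun_prop⟩
  have hF : ∀ k θ, ‖F k θ‖ = ‖(wcoef α k : ℂ)‖ := by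
    intro k θ
    simp only [F, ContinuousMap.coe_mk, norm_mul]
    rw [show (((k : ℤ) + m : ℤ) : ℂ) * (θ * Complex.I)
      = ((((k : ℤ) + m : ℤ) * θ : ℝ) : ℂ) * Complex.I by push_cast; ring,
      Complex.norm_exp_ofReal_mul_I, mul_one]
  have hs := intervalIntegral.hasSum_intervalIntegral_of_summable_norm (a := 0)
    (b := 2 * Real.pi) (f := F) (by
      refine (summable_norm_wcoef h1 h2).of_nonneg_of_le (fun _ => norm_nonneg _) fun k => ?_
      rw [ContinuousMap.norm_le _ (norm_nonneg _)]
      intro θ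
      exact (hF k θ).le)
  have hL : ∀ θ : ℝ, ∑' k, F k θ
      = wgen α (Complex.exp (θ * Complex.I)) * Complex.exp (m * (θ * Complex.I)) := by
    intro θ
    rw [wgen, ← tsum_mul_right]
    refine tsum_congr fun k => ?_
    simp only [F, ContinuousMap.coe_mk]
    rw [← Complex.exp_nat_mul, mul_assoc, ← Complex.exp_add]
    push_cast
    ring_nf
  simp only [hL] at hs
  rw [← hs.tsum_eq]
  simp only [F, ContinuousMap.coe_mk, intervalIntegral.integral_const_mul, integral_exp_int_mul_I]
  split_ifs with hm
  · rw [tsum_eq_single (-m).toNat]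
    · rw [if_pos (by omega)]; ring
    · intro k hk
      rw [if_neg (by omega), mul_zero]
  · rw [Complex.ofReal_zero, mul_zero]
    refine (tsum_congr fun k => ?_).trans tsum_zero
    rw [if_neg (by omega), mul_zero]

/-- The trigonometric polynomial with coefficient vector `u`. -/
noncomputable def trigPoly {M : ℕ} (u : Fin M → ℝ) (θ : ℝ) : ℂ :=
  ∑ i : Fin M, u i * Complex.exp ((i : ℕ) * (θ * Complex.I))

lemma continuous_trigPoly {M : ℕ} (u : Fin M → ℝ) : Continuous (trigPoly u) := by
  unfold trigPoly
  fun_prop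

open ComplexConjugate in
lemma conj_trigPoly {M : ℕ} (u : Fin M → ℝ) (θ : ℝ) :
    conj (trigPoly u θ) = ∑ i : Fin M, u i * Complex.exp (-((i : ℕ) * (θ * Complex.I))) := by
  simp [trigPoly, ← Complex.exp_conj]

open ComplexConjugate in
lemma integral_symbol_eq {α : ℝ} (h1 : 1 ≤ α) (h2 : α ≤ 2) {M : ℕ} (u v : Fin M → ℝ) :
    ∫ θ in (0 : ℝ)..(2 * Real.pi),
        (-(Complex.exp (-(θ * Complex.I)) * wgen α (Complex.exp (θ * Complex.I))))
          * (conj (trigPoly u θ) * trigPoly v θ)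
      = ((2 * Real.pi * -(u ⬝ᵥ Gmat α M *ᵥ v) : ℝ) : ℂ) := by
  have hc := continuous_wgen_exp h1 h2
  have hpt : ∀ θ : ℝ, (-(Complex.exp (-(θ * Complex.I)) * wgen α (Complex.exp (θ * Complex.I))))
          * (conj (trigPoly u θ) * trigPoly v θ)
      = ∑ i : Fin M, ∑ j : Fin M, (-(u i * v j) : ℂ) *
        (wgen α (Complex.exp (θ * Complex.I))
          * Complex.exp (((j : ℤ) - (i : ℤ) - 1 : ℤ) * (θ * Complex.I))) := by
    intro θ
    rw [conj_trigPoly, trigPoly, Finset.sum_mul_sum, Finset.mul_sum]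
    refine Finset.sum_congr rfl fun i _ => ?_
    rw [Finset.mul_sum]
    refine Finset.sum_congr rfl fun j _ => ?_
    rw [show (((j : ℤ) - (i : ℤ) - 1 : ℤ) : ℂ) * (θ * Complex.I)
      = -(θ * Complex.I) + (-((i : ℕ) * (θ * Complex.I)) + (j : ℕ) * (θ * Complex.I)) by
        push_cast; ring, Complex.exp_add, Complex.exp_add]
    ring
  simp only [hpt]
  rw [intervalIntegral.integral_finsetSum fun i _ =>
    (Continuous.intervalIntegrable (by fun_prop) _ _)]
  simp only [dotProduct, mulVec, Gmat, of_apply, Finset.mul_sum, ← Finset.sum_neg_distrib,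
    Complex.ofReal_sum]
  refine Finset.sum_congr rfl fun i _ => ?_
  rw [intervalIntegral.integral_finsetSum fun j _ =>
    (Continuous.intervalIntegrable (by fun_prop) _ _)]
  refine Finset.sum_congr rfl fun j _ => ?_
  rw [intervalIntegral.integral_const_mul, integral_wgen_mul_exp h1 h2]
  by_cases h : (j : ℕ) ≤ (i : ℕ) + 1
  · rw [if_pos h, if_pos (by omega), show (-((j : ℤ) - (i : ℤ) - 1)).toNat = (i : ℕ) + 1 - j by omega]
    push_cast
    ring
  · rw [if_neg h, if_neg (by omega)]
    simp

/-- Sector estimate for the bilinear form of `-G_α`, in the form of a weighted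
arithmetic-geometric mean inequality. -/
lemma abs_cos_mul_abs_bilin_le {α : ℝ} (hα : α ∈ Set.Ioo (1 : ℝ) 2) {M : ℕ} (u v : Fin M → ℝ)
    {t : ℝ} (ht : 0 ≤ t) :
    2 * t * |Real.cos (α * Real.pi / 2)| * |u ⬝ᵥ Gmat α M *ᵥ v| ≤
      -(u ⬝ᵥ Gmat α M *ᵥ u) + t ^ 2 * -(v ⬝ᵥ Gmat α M *ᵥ v) := by
  have h1 := hα.1.le
  have h2 := hα.2.le
  have hc := continuous_wgen_exp h1 h2
  have hpi : 0 < 2 * Real.pi := Real.two_pi_pos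
  set σ : ℝ → ℂ := fun θ =>
    -(Complex.exp (-(θ * Complex.I)) * wgen α (Complex.exp (θ * Complex.I))) with hσ
  have hσc : Continuous σ := by fun_prop
  have hq : ∀ x : Fin M → ℝ, 2 * Real.pi * -(x ⬝ᵥ Gmat α M *ᵥ x)
      = ∫ θ in (0 : ℝ)..(2 * Real.pi), (σ θ).re * ‖trigPoly x θ‖ ^ 2 := by
    intro x
    have hx := continuous_trigPoly x
    have := congrArg Complex.re (integral_symbol_eq h1 h2 x x)
    rw [Complex.ofReal_re] at this
    rw [← this, ← Complex.reCLM_apply, ← ContinuousLinearMap.intervalIntegral_comp_comm]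
    · refine intervalIntegral.integral_congr fun θ _ => ?_
      simp only [Complex.reCLM_apply]
      rw [Complex.conj_mul', ← Complex.ofReal_pow, Complex.re_mul_ofReal]
    · exact Continuous.intervalIntegrable (by fun_prop) _ _
  have hb : 2 * Real.pi * |u ⬝ᵥ Gmat α M *ᵥ v|
      ≤ ∫ θ in (0 : ℝ)..(2 * Real.pi), ‖σ θ‖ * (‖trigPoly u θ‖ * ‖trigPoly v θ‖) := by
    have := congrArg norm (integral_symbol_eq h1 h2 u v)
    rw [Complex.norm_real, Real.norm_eq_abs, abs_mul, abs_neg, abs_of_pos hpi] at this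
    rw [← this]
    refine (intervalIntegral.norm_integral_le_integral_norm hpi.le).trans (le_of_eq ?_)
    refine intervalIntegral.integral_congr fun θ _ => ?_
    simp only [norm_mul, hσ, RCLike.norm_conj]
  have hu := continuous_trigPoly u
  have hv := continuous_trigPoly v
  have hmono : ∫ θ in (0 : ℝ)..(2 * Real.pi), 2 * t * |Real.cos (α * Real.pi / 2)| *
        (‖σ θ‖ * (‖trigPoly u θ‖ * ‖trigPoly v θ‖))
      ≤ ∫ θ in (0 : ℝ)..(2 * Real.pi),
        ((σ θ).re * ‖trigPoly u θ‖ ^ 2 + t ^ 2 * ((σ θ).re * ‖trigPoly v θ‖ ^ 2)) := by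
    refine intervalIntegral.integral_mono_on_of_le_Ioo hpi.le
      (Continuous.intervalIntegrable (by fun_prop) _ _)
      (Continuous.intervalIntegrable (by fun_prop) _ _) fun θ hθ => ?_
    have hsec := abs_cos_mul_norm_wgen_le hα hθ.1 hθ.2
    have hn : ‖σ θ‖ = ‖wgen α (Complex.exp (θ * Complex.I))‖ := by
      rw [hσ, norm_neg, norm_mul, ← neg_mul, ← Complex.ofReal_neg,
        Complex.norm_exp_ofReal_mul_I, one_mul]
    rw [← hn] at hsec
    have hsec' : |Real.cos (α * Real.pi / 2)| * ‖σ θ‖ ≤ (σ θ).re := hsec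
    have hre : 0 ≤ (σ θ).re := hsec'.trans' (by positivity)
    calc _ = (|Real.cos (α * Real.pi / 2)| * ‖σ θ‖) *
          (2 * t * (‖trigPoly u θ‖ * ‖trigPoly v θ‖)) := by ring
      _ ≤ (σ θ).re * (2 * t * (‖trigPoly u θ‖ * ‖trigPoly v θ‖)) := by gcongr
      _ ≤ _ := by
        nlinarith [mul_nonneg hre (sq_nonneg (‖trigPoly u θ‖ - t * ‖trigPoly v θ‖))]
  rw [intervalIntegral.integral_const_mul, intervalIntegral.integral_add
    (Continuous.intervalIntegrable (by fun_prop) _ _)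
    (Continuous.intervalIntegrable (by fun_prop) _ _), intervalIntegral.integral_const_mul,
    ← hq, ← hq] at hmono
  have hcoef : 0 ≤ 2 * t * |Real.cos (α * Real.pi / 2)| := by positivity
  have := (mul_le_mul_of_nonneg_left hb hcoef).trans hmono
  refine le_of_mul_le_mul_left ?_ hpi
  linarith

lemma dotProduct_mulVec_nonneg_of_rowSum_nonneg {n : Type*} [Fintype n] (B : Matrix n n ℝ)
    (hoff : ∀ i j, i ≠ j → B i j + B j i ≤ 0) (hrow : ∀ i, 0 ≤ ∑ j, (B i j + B j i))
    (x : n → ℝ) : 0 ≤ x ⬝ᵥ B *ᵥ x := by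
  have e : x ⬝ᵥ B *ᵥ x = ∑ i, ∑ j, B i j * (x i * x j) := by
    simp only [dotProduct, mulVec, Finset.mul_sum]
    exact Finset.sum_congr rfl fun i _ => Finset.sum_congr rfl fun j _ => by ring
  have e' : x ⬝ᵥ B *ᵥ x = ∑ i, ∑ j, B j i * (x i * x j) := by
    rw [e, Finset.sum_comm]
    exact Finset.sum_congr rfl fun i _ => Finset.sum_congr rfl fun j _ => by ring
  have h2 : ∑ i, ∑ j, (B i j + B j i) * (2 * (x i * x j)) = 4 * (x ⬝ᵥ B *ᵥ x) := by
    rw [show 4 * (x ⬝ᵥ B *ᵥ x) = 2 * (x ⬝ᵥ B *ᵥ x) + 2 * (x ⬝ᵥ B *ᵥ x) by ring]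
    nth_rw 1 [e]
    rw [e']
    simp only [Finset.mul_sum, ← Finset.sum_add_distrib]
    exact Finset.sum_congr rfl fun i _ => Finset.sum_congr rfl fun j _ => by ring
  have h3 : ∑ i, ∑ j, (B i j + B j i) * (x i ^ 2 + x j ^ 2)
      ≤ ∑ i, ∑ j, (B i j + B j i) * (2 * (x i * x j)) := by
    refine Finset.sum_le_sum fun i _ => Finset.sum_le_sum fun j _ => ?_
    rcases eq_or_ne i j with rfl | h
    · exact le_of_eq (by ring)
    · nlinarith [hoff i j h, sq_nonneg (x i - x j)]
  have h4 : ∑ i, ∑ j, (B i j + B j i) * (x i ^ 2 + x j ^ 2)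
      = 2 * ∑ i, x i ^ 2 * ∑ j, (B i j + B j i) := by
    have h5 : ∑ i, ∑ j, (B i j + B j i) * x j ^ 2 = ∑ i, x i ^ 2 * ∑ j, (B i j + B j i) := by
      rw [Finset.sum_comm]
      simp only [Finset.mul_sum]
      exact Finset.sum_congr rfl fun i _ => Finset.sum_congr rfl fun j _ => by ring
    rw [two_mul]
    nth_rw 1 [← h5]
    simp only [Finset.mul_sum, ← Finset.sum_add_distrib]
    exact Finset.sum_congr rfl fun i _ => Finset.sum_congr rfl fun j _ => by ring
  have h6 : 0 ≤ ∑ i, x i ^ 2 * ∑ j, (B i j + B j i) :=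
    Finset.sum_nonneg fun i _ => mul_nonneg (sq_nonneg _) (hrow i)
  linarith

/-- The weight of the `(k+1)`-st off-diagonals of `G_α + G_αᵀ`. -/
noncomputable def offDiagWeight (α : ℝ) (k : ℕ) : ℝ :=
  wcoef α (k + 2) + if k = 0 then wcoef α 0 else 0

lemma offDiagWeight_nonneg {α : ℝ} (h1 : 1 ≤ α) (h2 : α ≤ 2) (k : ℕ) :
    0 ≤ offDiagWeight α k := by
  unfold offDiagWeight
  cases k with
  | zero => simpa [add_comm] using wcoef_zero_add_two_nonneg h1
  | succ k => simpa using wcoef_nonneg h1 h2 k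

lemma wcoef_one_add_sum_offDiagWeight_nonpos {α : ℝ} (h1 : 1 ≤ α) (h2 : α ≤ 2) {M : ℕ}
    (hM : 0 < M) : wcoef α 1 + ∑ k ∈ Finset.range M, offDiagWeight α k ≤ 0 := by
  obtain ⟨m, rfl⟩ : ∃ m, M = m + 1 := ⟨M - 1, by omega⟩
  have h := sum_wcoef_nonpos h1 h2 m
  rw [Finset.sum_range_succ', Finset.sum_range_succ'] at h
  simp only [offDiagWeight, Finset.sum_add_distrib, Finset.sum_ite_eq', Finset.mem_range,
    Nat.succ_pos, if_true]
  linarith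

lemma Gmat_add_transpose_apply (α : ℝ) {M : ℕ} (i j : Fin M) :
    Gmat α M i j + Gmat α M j i = (if j = i then 2 * wcoef α 1 else 0)
      + ∑ k ∈ Finset.range M, offDiagWeight α k *
        ((if (j : ℕ) = i + (k + 1) then 1 else 0) + if (i : ℕ) = j + (k + 1) then 1 else 0) := by
  have hi := i.2
  have hj := j.2
  simp only [Gmat, of_apply]
  rcases lt_trichotomy (i : ℕ) j with h | h | h
  · obtain ⟨m, hm⟩ : ∃ m, (j : ℕ) = i + (m + 1) := ⟨j - i - 1, by omega⟩
    rw [if_neg (by omega : j ≠ i), Finset.sum_eq_single m]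
    · rw [if_pos hm, if_neg (by omega : ¬ (i : ℕ) = j + (m + 1)), if_pos (by omega : (i : ℕ) ≤ j + 1),
        show (j : ℕ) + 1 - i = m + 2 by omega, offDiagWeight]
      rcases Nat.eq_zero_or_pos m with rfl | hm'
      · rw [if_pos (by omega), show (i : ℕ) + 1 - j = 0 by omega]; simp; ring
      · rw [if_neg (by omega), if_neg (by omega)]; ring
    · intro k _ hk
      rw [if_neg (by omega), if_neg (by omega)]; ring
    · intro hk
      exact absurd (Finset.mem_range.2 (by omega)) hk
  · rw [if_pos (Fin.ext h.symm), if_pos (by omega), if_pos (by omega), Finset.sum_eq_zero]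
    · rw [show (i : ℕ) + 1 - j = 1 by omega, show (j : ℕ) + 1 - i = 1 by omega]; ring
    · intro k _
      rw [if_neg (by omega), if_neg (by omega)]; ring
  · obtain ⟨m, hm⟩ : ∃ m, (i : ℕ) = j + (m + 1) := ⟨i - j - 1, by omega⟩
    rw [if_neg (by omega : j ≠ i), Finset.sum_eq_single m]
    · rw [if_pos hm, if_neg (by omega : ¬ (j : ℕ) = i + (m + 1)), if_pos (by omega : (j : ℕ) ≤ i + 1),
        show (i : ℕ) + 1 - j = m + 2 by omega, offDiagWeight]
      rcases Nat.eq_zero_or_pos m with rfl | hm'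
      · rw [if_pos (by omega), show (j : ℕ) + 1 - i = 0 by omega]; simp
      · rw [if_neg (by omega), if_neg (by omega)]; ring
    · intro k _ hk
      rw [if_neg (by omega), if_neg (by omega)]; ring
    · intro hk
      exact absurd (Finset.mem_range.2 (by omega)) hk

/-- Midpoint convexity of a finite sequence. -/
def MidConvex {M : ℕ} (e : Fin M → ℝ) : Prop :=
  ∀ i j l : Fin M, (j : ℕ) + l = 2 * i → 2 * e i ≤ e j + e l

lemma sum_shift_le {M : ℕ} {e : Fin M → ℝ} {c : ℝ} (h0 : ∀ i, 0 ≤ e i) (hc : ∀ i, e i ≤ c)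
    (hconv : MidConvex e) (i : Fin M) (k : ℕ) :
    ∑ j : Fin M, (2 * c ^ 2 - e i * e j) *
        ((if (j : ℕ) = i + (k + 1) then 1 else 0) + if (i : ℕ) = j + (k + 1) then 1 else 0)
      ≤ 2 * (2 * c ^ 2 - e i * e i) := by
  have hi0 := h0 i
  have hic := hc i
  have hee : e i * e i ≤ c ^ 2 := by nlinarith
  have hup : (∃ l : Fin M, (l : ℕ) = i + (k + 1) ∧
      ∑ j : Fin M, (2 * c ^ 2 - e i * e j) * (if (j : ℕ) = i + (k + 1) then 1 else 0)
        = 2 * c ^ 2 - e i * e l) ∨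
      ∑ j : Fin M, (2 * c ^ 2 - e i * e j) * (if (j : ℕ) = i + (k + 1) then 1 else 0) = 0 := by
    by_cases h : (i : ℕ) + (k + 1) < M
    · refine Or.inl ⟨⟨i + (k + 1), h⟩, rfl, ?_⟩
      rw [Finset.sum_eq_single ⟨i + (k + 1), h⟩] <;> simp [Fin.ext_iff]
      intro b hb hb'
      exact absurd hb' hb
    · refine Or.inr (Finset.sum_eq_zero fun j _ => ?_)
      rw [if_neg (by omega), mul_zero]
  have hdown : (∃ l : Fin M, (i : ℕ) = l + (k + 1) ∧
      ∑ j : Fin M, (2 * c ^ 2 - e i * e j) * (if (i : ℕ) = j + (k + 1) then 1 else 0)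
        = 2 * c ^ 2 - e i * e l) ∨
      ∑ j : Fin M, (2 * c ^ 2 - e i * e j) * (if (i : ℕ) = j + (k + 1) then 1 else 0) = 0 := by
    by_cases h : k + 1 ≤ (i : ℕ)
    · have hl : (i : ℕ) - (k + 1) < M := by omega
      refine Or.inl ⟨⟨i - (k + 1), hl⟩, by simp; omega, ?_⟩
      rw [Finset.sum_eq_single ⟨i - (k + 1), hl⟩]
      · rw [if_pos (by simp; omega), mul_one]
      · intro b _ hb
        rw [if_neg, mul_zero]
        intro h'
        exact hb (Fin.ext (by simp; omega))
      · simp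
    · refine Or.inr (Finset.sum_eq_zero fun j _ => ?_)
      rw [if_neg (by omega), mul_zero]
  simp only [mul_add, Finset.sum_add_distrib]
  rcases hup with ⟨l, hl, e1⟩ | e1 <;> rcases hdown with ⟨m, hm, e2⟩ | e2 <;> rw [e1, e2]
  · nlinarith [mul_le_mul_of_nonneg_left (hconv i l m (by omega)) hi0]
  · nlinarith [mul_nonneg hi0 (h0 l)]
  · nlinarith [mul_nonneg hi0 (h0 m)]
  · nlinarith

/-- Multiplication by a nonnegative convex sequence bounded by `c` increases the quadratic form
of `-G_α` by at most the factor `2 c²`. -/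
lemma quadForm_mul_le {α : ℝ} (h1 : 1 ≤ α) (h2 : α ≤ 2) {M : ℕ} {e : Fin M → ℝ} {c : ℝ}
    (h0 : ∀ i, 0 ≤ e i) (hc : ∀ i, e i ≤ c) (hconv : MidConvex e) (x : Fin M → ℝ) :
    -((e * x) ⬝ᵥ Gmat α M *ᵥ (e * x)) ≤ 2 * c ^ 2 * -(x ⬝ᵥ Gmat α M *ᵥ x) := by
  have hee : ∀ i j, e i * e j ≤ c ^ 2 := fun i j => by
    rw [sq]; exact mul_le_mul (hc i) (hc j) (h0 j) ((h0 i).trans (hc i))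
  let B : Matrix (Fin M) (Fin M) ℝ := of fun i j => (2 * c ^ 2 - e i * e j) * -Gmat α M i j
  have hB : ∀ i j, B i j + B j i
      = -((2 * c ^ 2 - e i * e j) * (Gmat α M i j + Gmat α M j i)) := by
    intro i j; simp only [B, of_apply]; ring
  have key := dotProduct_mulVec_nonneg_of_rowSum_nonneg B ?_ ?_ x
  · have e1 : x ⬝ᵥ B *ᵥ x
        = 2 * c ^ 2 * -(x ⬝ᵥ Gmat α M *ᵥ x) - -((e * x) ⬝ᵥ Gmat α M *ᵥ (e * x)) := by
      simp only [dotProduct, mulVec, Finset.mul_sum, ← Finset.sum_neg_distrib,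
        ← Finset.sum_sub_distrib]
      refine Finset.sum_congr rfl fun i _ => Finset.sum_congr rfl fun j _ => ?_
      simp only [B, of_apply, Pi.mul_apply]
      ring
    linarith
  · intro i j hij
    rw [hB, Gmat_add_transpose_apply, if_neg hij.symm, zero_add, neg_nonpos]
    refine mul_nonneg (by nlinarith [hee i j, sq_nonneg c]) (Finset.sum_nonneg fun k _ =>
      mul_nonneg (offDiagWeight_nonneg h1 h2 k) (by positivity))
  · intro i
    have hsum : ∑ j, (2 * c ^ 2 - e i * e j) * (Gmat α M i j + Gmat α M j i)
        ≤ 2 * (2 * c ^ 2 - e i * e i)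
          * (wcoef α 1 + ∑ k ∈ Finset.range M, offDiagWeight α k) := by
      simp only [Gmat_add_transpose_apply, mul_add _ (ite _ _ _) (Finset.sum _ _),
        Finset.sum_add_distrib (s := Finset.univ)]
      rw [mul_add (2 * (2 * c ^ 2 - e i * e i))]
      refine add_le_add (le_of_eq ?_) ?_
      · simp only [mul_ite, mul_zero, Finset.sum_ite_eq', Finset.mem_univ, if_true]
        ring
      · simp only [Finset.mul_sum (Finset.range M)]
        rw [Finset.sum_comm]
        refine Finset.sum_le_sum fun k _ => ?_
        have := mul_le_mul_of_nonneg_left (sum_shift_le h0 hc hconv i k)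
          (offDiagWeight_nonneg h1 h2 k)
        rw [Finset.mul_sum] at this
        calc _ = _ := Finset.sum_congr rfl fun j _ => by ring
          _ ≤ _ := this
          _ = _ := by ring
    have hw := wcoef_one_add_sum_offDiagWeight_nonpos h1 h2 i.pos
    have hpos : 0 ≤ 2 * (2 * c ^ 2 - e i * e i) := by nlinarith [hee i i, sq_nonneg c]
    simp only [hB, Finset.sum_neg_distrib]
    nlinarith [mul_nonneg hpos (neg_nonneg.2 hw)]

lemma quadForm_nonneg {α : ℝ} (hα : α ∈ Set.Ioo (1 : ℝ) 2) {M : ℕ} (x : Fin M → ℝ) :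
    0 ≤ -(x ⬝ᵥ Gmat α M *ᵥ x) := by
  simpa using abs_cos_mul_abs_bilin_le hα x x le_rfl

lemma abs_cos_pos {α : ℝ} (hα : α ∈ Set.Ioo (1 : ℝ) 2) :
    0 < |Real.cos (α * Real.pi / 2)| := by
  have hpi := Real.pi_pos
  refine abs_pos.2 (Real.cos_neg_of_pi_div_two_lt_of_lt ?_ ?_).ne
  · nlinarith [hα.1]
  · nlinarith [hα.2]

lemma abs_bilin_mul_le {α : ℝ} (hα : α ∈ Set.Ioo (1 : ℝ) 2) {M : ℕ} {e : Fin M → ℝ} {c : ℝ}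
    (h0 : ∀ i, 0 ≤ e i) (hc : ∀ i, e i ≤ c) (hc0 : 0 ≤ c) (hconv : MidConvex e)
    (x : Fin M → ℝ) :
    |(e * x) ⬝ᵥ Gmat α M *ᵥ x| ≤
      Real.sqrt 2 * c / |Real.cos (α * Real.pi / 2)| * -(x ⬝ᵥ Gmat α M *ᵥ x) := by
  rcases hc0.eq_or_lt with rfl | hcpos
  · have : e = 0 := funext fun i => le_antisymm (hc i) (h0 i)
    simp [this]
  · have hς := abs_cos_pos hα
    have hs : 0 < Real.sqrt 2 * c := by positivity
    have h := abs_cos_mul_abs_bilin_le hα (e * x) x hs.le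
    have h' := quadForm_mul_le hα.1.le hα.2.le h0 hc hconv x
    have hsq : (Real.sqrt 2 * c) ^ 2 = 2 * c ^ 2 := by
      rw [mul_pow, Real.sq_sqrt (by norm_num)]
    rw [div_mul_eq_mul_div, le_div_iff₀ hς]
    refine le_of_mul_le_mul_left ?_ (by positivity : 0 < 2 * (Real.sqrt 2 * c))
    rw [← hsq] at h'
    linarith

lemma weighted_bilin_bounds {α : ℝ} (hα : α ∈ Set.Ioo (1 : ℝ) 2) {M : ℕ} {δ : Fin M → ℝ}
    {κmin κmax : ℝ} (hκ : κmin ≤ κmax) (hδ : ∀ i, δ i ∈ Set.Icc κmin κmax)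
    (hconv : MidConvex δ) (x : Fin M → ℝ) :
    let ν := Real.sqrt 2 * (κmax - κmin) / |Real.cos (α * Real.pi / 2)|
    (κmin - ν) * -(x ⬝ᵥ Gmat α M *ᵥ x) ≤ -(x ⬝ᵥ (diagonal δ * Gmat α M) *ᵥ x) ∧
      -(x ⬝ᵥ (diagonal δ * Gmat α M) *ᵥ x) ≤ (κmin + ν) * -(x ⬝ᵥ Gmat α M *ᵥ x) := by
  intro ν
  have h := abs_bilin_mul_le hα (e := fun i => δ i - κmin) (c := κmax - κmin)
    (fun i => sub_nonneg.2 (hδ i).1) (fun i => sub_le_sub_right (hδ i).2 _)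
    (sub_nonneg.2 hκ) (fun i j l h => by have := hconv i j l h; linarith) x
  have e : x ⬝ᵥ (diagonal δ * Gmat α M) *ᵥ x
      = κmin * (x ⬝ᵥ Gmat α M *ᵥ x) + ((fun i => δ i - κmin) * x) ⬝ᵥ Gmat α M *ᵥ x := by
    rw [← mulVec_mulVec]
    simp only [dotProduct, mulVec_diagonal, Finset.mul_sum, ← Finset.sum_add_distrib,
      Pi.mul_apply]
    exact Finset.sum_congr rfl fun i _ => by ring
  rw [abs_le] at h
  rw [e]
  constructor <;> nlinarith [h.1, h.2]

lemma sq_one_sub_smul_mulVec {n : Type*} [Fintype n] [DecidableEq n] (η : ℝ) (B : Matrix n n ℝ)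
    (x : n → ℝ) :
    ((1 - η • B) *ᵥ x) ⬝ᵥ ((1 - η • B) *ᵥ x)
      = x ⬝ᵥ x + 2 * η * -(x ⬝ᵥ B *ᵥ x) + η ^ 2 * ((B *ᵥ x) ⬝ᵥ (B *ᵥ x)) := by
  rw [sub_mulVec, one_mulVec, smul_mulVec, sub_dotProduct, dotProduct_sub, dotProduct_sub,
    smul_dotProduct, dotProduct_smul, smul_dotProduct, dotProduct_smul,
    dotProduct_comm (B *ᵥ x) x]
  simp only [smul_eq_mul]
  ring

lemma diagonal_mulVec_sq_bounds {n : Type*} [Fintype n] [DecidableEq n] {δ : n → ℝ}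
    {κmin κmax : ℝ} (hκ : 0 < κmin) (hδ : ∀ i, δ i ∈ Set.Icc κmin κmax) (y : n → ℝ) :
    κmin ^ 2 * (y ⬝ᵥ y) ≤ (diagonal δ *ᵥ y) ⬝ᵥ (diagonal δ *ᵥ y) ∧
      (diagonal δ *ᵥ y) ⬝ᵥ (diagonal δ *ᵥ y) ≤ κmax ^ 2 * (y ⬝ᵥ y) := by
  simp only [dotProduct, mulVec_diagonal, Finset.mul_sum]
  constructor <;> refine Finset.sum_le_sum fun i _ => ?_
  · nlinarith [pow_le_pow_left₀ hκ.le (hδ i).1 2, mul_self_nonneg (y i)]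
  · nlinarith [pow_le_pow_left₀ (hκ.le.trans (hδ i).1) (hδ i).2 2, mul_self_nonneg (y i)]

lemma norm_toEuclideanCLM_le {n : Type*} [Fintype n] [DecidableEq n] (B : Matrix n n ℝ) {s : ℝ}
    (h : ∀ y, (B *ᵥ y) ⬝ᵥ (B *ᵥ y) ≤ s * (y ⬝ᵥ y)) :
    ‖Matrix.toEuclideanCLM (𝕜 := ℝ) B‖ ≤ Real.sqrt s := by
  refine ContinuousLinearMap.opNorm_le_bound _ (Real.sqrt_nonneg _) fun y => ?_
  have hn : ∀ z : EuclideanSpace ℝ n, ‖z‖ = Real.sqrt (z.ofLp ⬝ᵥ z.ofLp) := fun z => by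
    rw [EuclideanSpace.norm_eq]
    simp [dotProduct, sq]
  have hyy : 0 ≤ y.ofLp ⬝ᵥ y.ofLp := Finset.sum_nonneg fun i _ => mul_self_nonneg _
  rw [hn, hn, ← Real.sqrt_mul' _ hyy]
  exact Real.sqrt_le_sqrt (h y.ofLp)

lemma cond_le_of_sq_bounds {n : Type*} [Fintype n] [DecidableEq n] (B : Matrix n n ℝ) {s S : ℝ}
    (hs : 0 < s) (hl : ∀ y, s * (y ⬝ᵥ y) ≤ (B *ᵥ y) ⬝ᵥ (B *ᵥ y))
    (hu : ∀ y, (B *ᵥ y) ⬝ᵥ (B *ᵥ y) ≤ S * (y ⬝ᵥ y)) :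
    ‖Matrix.toEuclideanCLM (𝕜 := ℝ) B‖ * ‖Matrix.toEuclideanCLM (𝕜 := ℝ) B⁻¹‖
      ≤ Real.sqrt (S / s) := by
  have hB : IsUnit B := by
    rw [← mulVec_injective_iff_isUnit]
    refine (injective_iff_map_eq_zero (B.mulVecLin)).2 fun y hy => ?_
    have hy' : B *ᵥ y = 0 := hy
    have h := hl y
    rw [hy', zero_dotProduct] at h
    have h0 : 0 ≤ y ⬝ᵥ y := Finset.sum_nonneg fun i _ => mul_self_nonneg _
    exact dotProduct_self_eq_zero.1 (by nlinarith)
  have hinv : ‖Matrix.toEuclideanCLM (𝕜 := ℝ) B⁻¹‖ ≤ Real.sqrt s⁻¹ := by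
    refine norm_toEuclideanCLM_le _ fun y => ?_
    have h := hl (B⁻¹ *ᵥ y)
    rw [mulVec_mulVec, mul_nonsing_inv _ ((isUnit_iff_isUnit_det _).1 hB), one_mulVec] at h
    rwa [inv_mul_eq_div, le_div_iff₀' hs]
  rw [div_eq_mul_inv, Real.sqrt_mul' _ (inv_nonneg.2 hs.le)]
  exact mul_le_mul (norm_toEuclideanCLM_le _ hu) hinv (norm_nonneg _) (Real.sqrt_nonneg _)

lemma isUnit_one_sub_smul_Gmat {α : ℝ} (hα : α ∈ Set.Ioo (1 : ℝ) 2) {M : ℕ} {t : ℝ}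
    (ht : 0 ≤ t) : IsUnit (1 - t • Gmat α M) := by
  rw [← mulVec_injective_iff_isUnit]
  refine (injective_iff_map_eq_zero ((1 - t • Gmat α M).mulVecLin)).2 fun x hx => ?_
  have hx' : (1 - t • Gmat α M) *ᵥ x = 0 := hx
  have h := sq_one_sub_smul_mulVec t (Gmat α M) x
  rw [hx', zero_dotProduct] at h
  have h0 : 0 ≤ x ⬝ᵥ x := Finset.sum_nonneg fun i _ => mul_self_nonneg _
  have h1 : 0 ≤ (Gmat α M *ᵥ x) ⬝ᵥ (Gmat α M *ᵥ x) :=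
    Finset.sum_nonneg fun i _ => mul_self_nonneg _
  have h2 := mul_nonneg ht (quadForm_nonneg hα x)
  exact dotProduct_self_eq_zero.1 (by nlinarith [mul_nonneg (sq_nonneg t) h1])

lemma average_mem_Icc {M : ℕ} (hM : 0 < M) {δ : Fin M → ℝ} {a b : ℝ}
    (hδ : ∀ i, δ i ∈ Set.Icc a b) : (∑ i, δ i) / M ∈ Set.Icc a b := by
  have hM' : (0 : ℝ) < M := by exact_mod_cast hM
  have hl := Finset.card_nsmul_le_sum Finset.univ δ a fun i _ => (hδ i).1
  have hu := Finset.sum_le_card_nsmul Finset.univ δ b fun i _ => (hδ i).2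
  rw [Finset.card_univ, Fintype.card_fin, nsmul_eq_mul] at hl hu
  exact ⟨by rw [le_div_iff₀ hM']; linarith, by rw [div_le_iff₀ hM']; linarith⟩

lemma midConvex_of_convexOn {xL xR : ℝ} {M : ℕ} {d : ℝ → ℝ}
    (hconv : ConvexOn ℝ (Set.Ioo xL xR) d) {X : Fin M → ℝ}
    (hX : ∀ i, X i = xL + ((i : ℕ) + 1) * ((xR - xL) / (M + 1)))
    (hmem : ∀ i, X i ∈ Set.Ioo xL xR) : MidConvex fun i => d (X i) := by
  intro i j l h
  have h' : ((j : ℕ) : ℝ) + (l : ℕ) = 2 * (i : ℕ) := by exact_mod_cast h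
  have := hconv.2 (hmem j) (hmem l) (by norm_num : (0 : ℝ) ≤ 1 / 2)
    (by norm_num : (0 : ℝ) ≤ 1 / 2) (by norm_num)
  have hmid : (1 / 2 : ℝ) • X j + (1 / 2 : ℝ) • X l = X i := by
    simp only [smul_eq_mul, hX]
    linear_combination (xR - xL) / (M + 1) / 2 * h'
  rw [hmid] at this
  simp only [smul_eq_mul] at this
  linarith

lemma gridPoint_mem_Ioo {xL xR : ℝ} (hx : xL < xR) {M : ℕ} (i : Fin M) :
    xL + ((i : ℕ) + 1) * ((xR - xL) / (M + 1)) ∈ Set.Ioo xL xR := by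
  have hM : (0 : ℝ) < M + 1 := by positivity
  have hh : 0 < (xR - xL) / (M + 1) := div_pos (sub_pos.2 hx) hM
  have hi : ((i : ℕ) : ℝ) + 1 < M + 1 := by exact_mod_cast Nat.succ_lt_succ i.2
  refine ⟨by nlinarith [mul_pos (by positivity : (0 : ℝ) < (i : ℕ) + 1) hh], ?_⟩
  have := mul_lt_mul_of_pos_right hi hh
  rw [mul_div_cancel₀ _ hM.ne'] at this
  linarith

lemma sq_norm_bounds {α : ℝ} (hα : α ∈ Set.Ioo (1 : ℝ) 2) {M : ℕ} {δ : Fin M → ℝ}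
    {κmin κmax : ℝ} (hκ : 0 < κmin) (hκ' : κmin ≤ κmax)
    (hδ : ∀ i, δ i ∈ Set.Icc κmin κmax) (hconv : MidConvex δ)
    {dbar : ℝ} (hdbar : dbar ∈ Set.Icc κmin κmax) {η : ℝ} (hη : 0 < η) {ν sLow sUp : ℝ}
    (hν : ν = Real.sqrt 2 * (κmax - κmin) / |Real.cos (α * Real.pi / 2)|)
    (hs0 : 0 ≤ sLow) (hs1 : sLow ≤ (κmin - ν) / κmax) (hs2 : sLow ≤ κmin ^ 2 / κmax ^ 2)
    (hS1 : (κmin + ν) / κmin ≤ sUp) (hS2 : κmax ^ 2 / κmin ^ 2 ≤ sUp) (x : Fin M → ℝ) :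
    let A := 1 - η • (diagonal δ * Gmat α M)
    let P := 1 - (η * dbar) • Gmat α M
    sLow * ((P *ᵥ x) ⬝ᵥ (P *ᵥ x)) ≤ (A *ᵥ x) ⬝ᵥ (A *ᵥ x) ∧
      (A *ᵥ x) ⬝ᵥ (A *ᵥ x) ≤ sUp * ((P *ᵥ x) ⬝ᵥ (P *ᵥ x)) := by
  intro A P
  obtain ⟨hd1, hd2⟩ := hdbar
  have hκmax : 0 < κmax := hκ.trans_le hκ'
  have hw := weighted_bilin_bounds hα hκ' hδ hconv x
  simp only [← hν] at hw
  have hD := diagonal_mulVec_sq_bounds hκ hδ (Gmat α M *ᵥ x)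
  rw [mulVec_mulVec] at hD
  have hxx : 0 ≤ x ⬝ᵥ x := Finset.sum_nonneg fun i _ => mul_self_nonneg _
  have hGG : 0 ≤ (Gmat α M *ᵥ x) ⬝ᵥ (Gmat α M *ᵥ x) :=
    Finset.sum_nonneg fun i _ => mul_self_nonneg _
  have hQ := quadForm_nonneg hα x
  rw [le_div_iff₀ (by positivity)] at hs1 hs2
  rw [div_le_iff₀ (by positivity)] at hS1 hS2
  have hsq : κmin ^ 2 ≤ κmax ^ 2 := pow_le_pow_left₀ hκ.le hκ' 2
  have hs3 : sLow ≤ 1 := by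
    by_contra! h
    nlinarith [pow_pos hκmax 2]
  have hS3 : 1 ≤ sUp := by
    by_contra! h
    nlinarith [pow_pos hκ 2]
  have hS0 : 0 ≤ sUp := zero_le_one.trans hS3
  have hd0 : 0 ≤ dbar := hκ.le.trans hd1
  rw [sq_one_sub_smul_mulVec, sq_one_sub_smul_mulVec]
  generalize x ⬝ᵥ x = a at *
  generalize (Gmat α M *ᵥ x) ⬝ᵥ (Gmat α M *ᵥ x) = g at *
  generalize -(x ⬝ᵥ Gmat α M *ᵥ x) = q at *
  generalize -(x ⬝ᵥ (diagonal δ * Gmat α M) *ᵥ x) = p at *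
  generalize ((diagonal δ * Gmat α M) *ᵥ x) ⬝ᵥ ((diagonal δ * Gmat α M) *ᵥ x) = r at *
  constructor
  · have t1 : sLow * a ≤ a := mul_le_of_le_one_left hxx hs3
    have t2 : sLow * dbar * q ≤ p :=
      (mul_le_mul_of_nonneg_right ((mul_le_mul_of_nonneg_left hd2 hs0).trans hs1) hQ).trans hw.1
    have t3 : sLow * dbar ^ 2 * g ≤ r :=
      (mul_le_mul_of_nonneg_right ((mul_le_mul_of_nonneg_left
        (pow_le_pow_left₀ hd0 hd2 2) hs0).trans hs2) hGG).trans hD.1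
    have t2' := mul_le_mul_of_nonneg_left t2 (by positivity : 0 ≤ 2 * η)
    have t3' := mul_le_mul_of_nonneg_left t3 (sq_nonneg η)
    linarith
  · have t1 : a ≤ sUp * a := le_mul_of_one_le_left hxx hS3
    have t2 : p ≤ sUp * dbar * q :=
      hw.2.trans (mul_le_mul_of_nonneg_right
        (hS1.trans (mul_le_mul_of_nonneg_left hd1 hS0)) hQ)
    have t3 : r ≤ sUp * dbar ^ 2 * g :=
      hD.2.trans (mul_le_mul_of_nonneg_right (hS2.trans (mul_le_mul_of_nonneg_left
        (pow_le_pow_left₀ hκ.le hd1 2) hS0)) hGG)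
    have t2' := mul_le_mul_of_nonneg_left t2 (by positivity : 0 ≤ 2 * η)
    have t3' := mul_le_mul_of_nonneg_left t3 (sq_nonneg η)
    linarith

/-- Theorem 2.4: condition-number estimate for the Toeplitz-preconditioned matrix,
convex case. With `A = I − η D G_α`, `P = I − η d̄ G_α`, `d` convex,
`d(x) ∈ [κ_min, κ_max]`, `κ_min − ν_α > 0` where `ν_α = √2(κ_max−κ_min)/ς_α`:
`P` is invertible, the Rayleigh quotient `‖A P⁻¹ y‖₂²/‖y‖₂²` lies in `[sLow, sUp]`
for every nonzero `y` (hence all singular values of `AP⁻¹` lie in `[√sLow, √sUp]`),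
and `cond(AP⁻¹) = ‖AP⁻¹‖₂ ‖(AP⁻¹)⁻¹‖₂ ≤ √(sUp/sLow)`. -/
theorem toeplitz_preconditioned_cond_convex (α : ℝ) (hα : α ∈ Set.Ioo (1 : ℝ) 2)
    (xL xR : ℝ) (hx : xL < xR) (M : ℕ) (hM : 0 < M)
    (d : ℝ → ℝ) (κmin κmax : ℝ) (hκmin : 0 < κmin) (hκmax : 0 < κmax)
    (hbound : ∀ x ∈ Set.Ioo xL xR, d x ∈ Set.Icc κmin κmax)
    (hconv : ConvexOn ℝ (Set.Ioo xL xR) d)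
    (hν : 0 < κmin - Real.sqrt 2 * (κmax - κmin) / |Real.cos (α * Real.pi / 2)|)
    (η : ℝ) (hη : 0 < η) :
    let h := (xR - xL) / (M + 1)
    let X : Fin M → ℝ := fun i => xL + ((i : ℕ) + 1) * h
    let D : Matrix (Fin M) (Fin M) ℝ := Matrix.diagonal fun i => d (X i)
    let dbar := (∑ i : Fin M, d (X i)) / M
    let A := (1 : Matrix (Fin M) (Fin M) ℝ) - η • (D * Gmat α M)
    let P := (1 : Matrix (Fin M) (Fin M) ℝ) - (η * dbar) • Gmat α M
    let να := Real.sqrt 2 * (κmax - κmin) / |Real.cos (α * Real.pi / 2)|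
    let sLow := min ((κmin - να) / κmax) (κmin ^ 2 / κmax ^ 2)
    let sUp := max ((κmin + να) / κmin) (κmax ^ 2 / κmin ^ 2)
    IsUnit P ∧
    (∀ y : Fin M → ℝ, y ≠ 0 →
      sLow ≤ (((A * P⁻¹) *ᵥ y) ⬝ᵥ ((A * P⁻¹) *ᵥ y)) / (y ⬝ᵥ y) ∧
      (((A * P⁻¹) *ᵥ y) ⬝ᵥ ((A * P⁻¹) *ᵥ y)) / (y ⬝ᵥ y) ≤ sUp) ∧
    ‖Matrix.toEuclideanCLM (𝕜 := ℝ) (A * P⁻¹)‖ *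
        ‖Matrix.toEuclideanCLM (𝕜 := ℝ) ((A * P⁻¹)⁻¹)‖ ≤ Real.sqrt (sUp / sLow) := by
  intro h X D dbar A P να sLow sUp
  have hmem : ∀ i, X i ∈ Set.Ioo xL xR := gridPoint_mem_Ioo hx
  have hδ : ∀ i, d (X i) ∈ Set.Icc κmin κmax := fun i => hbound _ (hmem i)
  have hκ : κmin ≤ κmax := (hδ ⟨0, hM⟩).1.trans (hδ ⟨0, hM⟩).2
  have hdbar : dbar ∈ Set.Icc κmin κmax := average_mem_Icc hM hδ
  have hs : 0 < sLow := lt_min (div_pos hν hκmax) (by positivity)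
  have hP : IsUnit P :=
    isUnit_one_sub_smul_Gmat hα (mul_nonneg hη.le (hκmin.le.trans hdbar.1))
  have hb : ∀ y, sLow * (y ⬝ᵥ y) ≤ ((A * P⁻¹) *ᵥ y) ⬝ᵥ ((A * P⁻¹) *ᵥ y) ∧
      ((A * P⁻¹) *ᵥ y) ⬝ᵥ ((A * P⁻¹) *ᵥ y) ≤ sUp * (y ⬝ᵥ y) := by
    intro y
    have hx := sq_norm_bounds hα hκmin hκ hδ
      (midConvex_of_convexOn hconv (fun _ => rfl) hmem) hdbar hη (ν := να) rfl hs.le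
      (min_le_left _ _) (min_le_right _ _) (le_max_left _ _) (le_max_right _ _) (P⁻¹ *ᵥ y)
    have hPy : P *ᵥ (P⁻¹ *ᵥ y) = y := by
      rw [mulVec_mulVec, mul_nonsing_inv _ ((isUnit_iff_isUnit_det _).1 hP), one_mulVec]
    rw [← mulVec_mulVec]
    change sLow * ((P *ᵥ (P⁻¹ *ᵥ y)) ⬝ᵥ (P *ᵥ (P⁻¹ *ᵥ y))) ≤
      (A *ᵥ (P⁻¹ *ᵥ y)) ⬝ᵥ (A *ᵥ (P⁻¹ *ᵥ y)) ∧ (A *ᵥ (P⁻¹ *ᵥ y)) ⬝ᵥ (A *ᵥ (P⁻¹ *ᵥ y)) ≤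
      sUp * ((P *ᵥ (P⁻¹ *ᵥ y)) ⬝ᵥ (P *ᵥ (P⁻¹ *ᵥ y))) at hx
    rwa [hPy] at hx
  refine ⟨hP, fun y hy => ?_, cond_le_of_sq_bounds _ hs (fun y => (hb y).1) fun y => (hb y).2⟩
  have hyy : 0 < y ⬝ᵥ y :=
    lt_of_le_of_ne (Finset.sum_nonneg fun i _ => mul_self_nonneg _)
      (Ne.symm (dotProduct_self_eq_zero.not.2 hy))
  rw [le_div_iff₀ hyy, div_le_iff₀ hyy]
  exact hb y
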